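/- Let G be a finite connected graph with shortest-path metric d, let W : V → ℝ be a weight function such that for all distinct vertices v, v' the difference W(v) − W(v') is not an integer, and let c : V → V be an additively weighted Voronoi assignment for W. Then every AWVD cell is star-shaped about its generator: for every vertex u with c(u) ≠ u, there exists a neighbor w of u with d(w, c(u)) = d(u, c(u)) − 1 and c(w) = c(u). In particular, every vertex of the cell generated by g is joined to g by a shortest path all of whose vertices lie in that cell. -/

import Mathlib

open SimpleGraph

/-- In a connected graph, a vertex `u ≠ g` has a neighbor one step closer to `g`. -/
theorem SimpleGraph.Connected.exists_adj_dist_add_one_eq {V : Type*} {G : SimpleGraph V}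
    (hG : G.Connected) {u g : V} (hne : u ≠ g) :
    ∃ w : V, G.Adj u w ∧ G.dist w g + 1 = G.dist u g := by
  obtain ⟨p, hp⟩ := hG.exists_walk_length_eq_dist u g
  cases p with
  | nil => exact absurd rfl hne
  | @cons _ w _ h q =>
    refine ⟨w, h, ?_⟩
    have hq : G.dist w g ≤ q.length := dist_le q
    have htri : G.dist u g ≤ G.dist u w + G.dist w g := hG.dist_triangle
    have huw : G.dist u w = 1 := dist_eq_one_iff_adj.mpr h
    rw [Walk.length_cons] at hp
    omega

/-- A neighbor of `u` one step closer to the generator of the cell of `u` lies in that cell. -/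
theorem awvd_eq_of_adj_of_dist_add_one_eq {V : Type*} {G : SimpleGraph V} (hG : G.Connected)
    {W : V → ℝ} (hW : ∀ v v' : V, v ≠ v' → ∀ k : ℤ, W v - W v' ≠ (k : ℝ)) {c : V → V}
    (hc : ∀ u v : V, (G.dist u (c u) : ℝ) - W (c u) ≤ (G.dist u v : ℝ) - W v)
    {u w : V} (huw : G.Adj u w) (hd : G.dist w (c u) + 1 = G.dist u (c u)) : c w = c u := by
  by_contra hne
  have htri : G.dist u (c w) ≤ G.dist u w + G.dist w (c w) := hG.dist_triangle
  rw [dist_eq_one_iff_adj.mpr huw] at htri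
  have htri' : (G.dist u (c w) : ℝ) ≤ 1 + G.dist w (c w) := mod_cast htri
  have hd' : (G.dist w (c u) : ℝ) + 1 = G.dist u (c u) := mod_cast hd
  apply hW _ _ hne ((G.dist w (c w) : ℤ) - G.dist w (c u))
  push_cast
  linarith [hc w (c u), hc u (c w)]

/-- If no two weights differ by an integer and `c : V → V` is
an additively weighted Voronoi assignment for `W` on a finite connected graph,
then every cell is star-shaped about its generator: each vertex `u` with
`c u ≠ u` has a neighbor `w` one step closer to the generator with `c w = c u`;
in particular every vertex is joined to the generator of its cell by a shortest
path lying entirely inside the cell. -/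
theorem awvd_cells_star_shaped
    {V : Type*} [Fintype V] (G : SimpleGraph V) (hG : G.Connected)
    (W : V → ℝ)
    (hW : ∀ v v' : V, v ≠ v' → ∀ k : ℤ, W v - W v' ≠ (k : ℝ))
    (c : V → V)
    (hc : ∀ u v : V, (G.dist u (c u) : ℝ) - W (c u) ≤ (G.dist u v : ℝ) - W v) :
    (∀ u : V, c u ≠ u →
      ∃ w : V, G.Adj u w ∧ G.dist w (c u) + 1 = G.dist u (c u) ∧ c w = c u) ∧
    (∀ u : V, ∃ p : G.Walk u (c u),
      p.length = G.dist u (c u) ∧ ∀ w ∈ p.support, c w = c u) := by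
  have hstep : ∀ u : V, c u ≠ u →
      ∃ w : V, G.Adj u w ∧ G.dist w (c u) + 1 = G.dist u (c u) ∧ c w = c u := by
    intro u hu
    obtain ⟨w, huw, hd⟩ := hG.exists_adj_dist_add_one_eq hu.symm
    exact ⟨w, huw, hd, awvd_eq_of_adj_of_dist_add_one_eq hG hW hc huw hd⟩
  refine ⟨hstep, fun u => ?_⟩
  suffices h : ∀ (n : ℕ) (g u : V), c u = g → G.dist u g = n →
      ∃ p : G.Walk u g, p.length = n ∧ ∀ w ∈ p.support, c w = g from
    h _ _ u rfl rfl
  intro n g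
  induction n with
  | zero =>
    intro u hu hd
    obtain rfl := hG.dist_eq_zero_iff.mp hd
    exact ⟨Walk.nil, rfl, by simpa using hu⟩
  | succ n ih =>
    rintro u rfl hd
    have hne : c u ≠ u := by
      intro h
      rw [h, dist_self] at hd
      omega
    obtain ⟨w, huw, hdw, hw⟩ := hstep u hne
    obtain ⟨p, hp, hs⟩ := ih w hw (by omega)
    refine ⟨Walk.cons huw p, by simp [hp], ?_⟩
    simpa using hs
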